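/- Assume the right derivative f′(0) is finite, and fix ε ∈ (0, sup f). Then the map ℒ_ε is a homeomorphism of Ω = (−1,+∞)×(0,1) onto Ω_ε, Lipschitz on compact subsets together with its inverse, with Jacobian j_ε(s,t) = g_ε′(s) f_ε(g_ε(s)), and for every compactly supported C¹ function u on ℝ², setting ψ = √ε · (u ∘ ℒ_ε), one has the change-of-variables identity ∫_{Ω_ε} |∇u|² γ dx dy = ∫_Ω [ ( ∂_sψ/g_ε′ − ((f_ε′∘g_ε)/(f_ε∘g_ε)) t ∂_tψ )² + (∂_tψ)²/(f_ε∘g_ε)² ] γ_ε g_ε′ (f_ε∘g_ε)/ε ds dt, where f_ε′ denotes the almost-everywhere derivative of f_ε and the partial derivatives of the Lipschitz function ψ are taken almost everywhere. -/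

import Mathlib

open MeasureTheory Real Set Filter Topology

/-- The shifted Gaussian density `γ(x,y) = exp(-((x₀+x)² + (y₀+y)²)/2)`. -/
noncomputable def shiftDensity (x₀ y₀ : ℝ) (z : ℝ × ℝ) : ℝ :=
  Real.exp (-((x₀ + z.1) ^ 2 + (y₀ + z.2) ^ 2) / 2)

/-- The measure `γ dx dy` on `ℝ²` with the shifted Gaussian density. -/
noncomputable def mShift (x₀ y₀ : ℝ) : Measure (ℝ × ℝ) :=
  volume.withDensity fun z => ENNReal.ofReal (shiftDensity x₀ y₀ z)

/-- `f_ε = min(ε, f)`. -/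
noncomputable def fEps (f : ℝ → ℝ) (ε : ℝ) (x : ℝ) : ℝ := min ε (f x)

/-- `a_ε = inf{x > 0 : f(x) ≥ ε}`. -/
noncomputable def aEps (f : ℝ → ℝ) (ε : ℝ) : ℝ := sInf {x : ℝ | 0 < x ∧ ε ≤ f x}

/-- The auxiliary change of horizontal variable `g_ε`. -/
noncomputable def gEps (f : ℝ → ℝ) (ε : ℝ) (s : ℝ) : ℝ :=
  if s < 0 then aEps f ε * s + aEps f ε else s + aEps f ε

/-- The derivative of `g_ε` (piecewise constant). -/
noncomputable def gEps' (f : ℝ → ℝ) (ε : ℝ) (s : ℝ) : ℝ :=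
  if s < 0 then aEps f ε else 1

/-- The fixed reference domain `Ω = (-1,+∞) × (0,1)`. -/
def domOmega : Set (ℝ × ℝ) := Set.Ioi (-1 : ℝ) ×ˢ Set.Ioo (0 : ℝ) 1

/-- The thin domain `Ω_ε = {(x,y) : x > 0, 0 < y < f_ε(x)}`. -/
def thinOmega (f : ℝ → ℝ) (ε : ℝ) : Set (ℝ × ℝ) :=
  {z : ℝ × ℝ | 0 < z.1 ∧ 0 < z.2 ∧ z.2 < fEps f ε z.1}

/-- The mapping `ℒ_ε(s,t) = (g_ε(s), f_ε(g_ε(s)) t)`. -/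
noncomputable def mapL (f : ℝ → ℝ) (ε : ℝ) (z : ℝ × ℝ) : ℝ × ℝ :=
  (gEps f ε z.1, fEps f ε (gEps f ε z.1) * z.2)

/-- The Jacobian `j_ε(s,t) = g_ε'(s) f_ε(g_ε(s))`. -/
noncomputable def jacEps (f : ℝ → ℝ) (ε : ℝ) (z : ℝ × ℝ) : ℝ :=
  gEps' f ε z.1 * fEps f ε (gEps f ε z.1)


lemma lip_helper (F : ℝ × ℝ → ℝ × ℝ) (K : Set (ℝ × ℝ)) (A B C : ℝ) (hA : 0 ≤ A) (hB : 0 ≤ B)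
    (hC : 0 ≤ C)
    (h1 : ∀ z ∈ K, ∀ w ∈ K, |(F z).1 - (F w).1| ≤ A * |z.1 - w.1|)
    (h2 : ∀ z ∈ K, ∀ w ∈ K, |(F z).2 - (F w).2| ≤ B * |z.1 - w.1| + C * |z.2 - w.2|) :
    ∃ Lip : NNReal, LipschitzOnWith Lip F K := by
  refine ⟨⟨A + B + C, by positivity⟩, LipschitzOnWith.of_dist_le_mul ?_⟩
  intro z hz w hw
  have e1 : |z.1 - w.1| ≤ dist z w := by
    rw [Prod.dist_eq, Real.dist_eq]; exact le_max_left _ _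
  have e2 : |z.2 - w.2| ≤ dist z w := by
    rw [Prod.dist_eq, Real.dist_eq z.2]; exact le_max_right _ _
  have hd : 0 ≤ dist z w := dist_nonneg
  change dist (F z) (F w) ≤ (A + B + C) * dist z w
  rw [Prod.dist_eq (x := F z), Real.dist_eq, Real.dist_eq]
  have g1 := h1 z hz w hw
  have g2 := h2 z hz w hw
  have m1 := mul_le_mul_of_nonneg_left e1 hA
  have m2 := mul_le_mul_of_nonneg_left e1 hB
  have m3 := mul_le_mul_of_nonneg_left e2 hC
  have n1 := mul_nonneg hA hd
  have n2 := mul_nonneg hB hd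
  have n3 := mul_nonneg hC hd
  apply max_le <;> linarith

/-- inverse of `gEps` -/
noncomputable def gInv (a : ℝ) (x : ℝ) : ℝ := if x < a then (x - a) / a else x - a

noncomputable def mapLinv (f : ℝ → ℝ) (ε : ℝ) (w : ℝ × ℝ) : ℝ × ℝ :=
  (gInv (aEps f ε) w.1, w.2 / fEps f ε w.1)

lemma gInv_gEps {f : ℝ → ℝ} {ε : ℝ} (ha : 0 < aEps f ε) (s : ℝ) :
    gInv (aEps f ε) (gEps f ε s) = s := by
  unfold gInv gEps
  by_cases hs : s < 0
  · have : aEps f ε * s < 0 := mul_neg_of_pos_of_neg ha hs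
    rw [if_pos hs, if_pos (by linarith)]; field_simp; ring
  · rw [if_neg hs, if_neg (by linarith)]; ring

lemma gEps_gInv {f : ℝ → ℝ} {ε : ℝ} (ha : 0 < aEps f ε) (x : ℝ) :
    gEps f ε (gInv (aEps f ε) x) = x := by
  unfold gInv gEps
  by_cases hs : x < aEps f ε
  · have : (x - aEps f ε) / aEps f ε < 0 := div_neg_of_neg_of_pos (by linarith) ha
    rw [if_pos hs, if_pos this]; field_simp; ring
  · rw [if_neg hs, if_neg (by linarith)]; ring

lemma gEps_pos {f : ℝ → ℝ} {ε : ℝ} (ha : 0 < aEps f ε) {s : ℝ} (hs : -1 < s) :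
    0 < gEps f ε s := by
  unfold gEps; split_ifs <;> nlinarith

lemma gInv_gt {a : ℝ} (ha : 0 < a) {x : ℝ} (hx : 0 < x) : -1 < gInv a x := by
  unfold gInv; split_ifs with h
  · rw [lt_div_iff₀ ha]; linarith
  · linarith

lemma gEps_lip {f : ℝ → ℝ} {ε : ℝ} (ha : 0 < aEps f ε) (s t : ℝ) :
    |gEps f ε s - gEps f ε t| ≤ (aEps f ε + 1) * |s - t| := by
  unfold gEps
  rcases abs_cases (s - t) with ⟨h, h'⟩ | ⟨h, h'⟩ <;> rw [h, abs_le] <;> split_ifs <;>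
    constructor <;> nlinarith

lemma gInv_lip {a : ℝ} (ha : 0 < a) (s t : ℝ) :
    |gInv a s - gInv a t| ≤ (a⁻¹ + 1) * |s - t| := by
  have hb : 0 < a⁻¹ := inv_pos.mpr ha
  unfold gInv
  simp only [div_eq_mul_inv]
  rcases abs_cases (s - t) with ⟨h, h'⟩ | ⟨h, h'⟩ <;> rw [h, abs_le] <;> split_ifs <;>
    constructor <;> nlinarith

lemma gEps_hasDerivAt {f : ℝ → ℝ} {ε : ℝ} {s : ℝ} (hs : s ≠ 0) :
    HasDerivAt (gEps f ε) (gEps' f ε s) s := by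
  rcases lt_or_gt_of_ne hs with h | h
  · have : HasDerivAt (fun s => aEps f ε * s + aEps f ε) (aEps f ε * 1) s :=
      ((hasDerivAt_id s).const_mul _).add_const _
    rw [gEps', if_pos h]
    rw [mul_one] at this
    refine this.congr_of_eventuallyEq ?_
    filter_upwards [Iio_mem_nhds h] with x hx
    exact if_pos hx
  · have : HasDerivAt (fun s => s + aEps f ε) 1 s := (hasDerivAt_id s).add_const _
    rw [gEps', if_neg (by linarith)]
    refine this.congr_of_eventuallyEq ?_
    filter_upwards [Ioi_mem_nhds h] with x hx
    have hx' : 0 < x := hx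
    rw [gEps, if_neg (by linarith)]

lemma ae_comp_gEps {f : ℝ → ℝ} {ε : ℝ} (ha : 0 < aEps f ε) {P : ℝ → Prop}
    (hP : ∀ᵐ x : ℝ, P x) : ∀ᵐ s : ℝ, P (gEps f ε s) := by
  rw [ae_iff] at hP ⊢
  set N := {x | ¬ P x}
  have h1 : volume ((fun s : ℝ => s + aEps f ε) ⁻¹' N) = 0 := by
    rw [measure_preimage_add_right]; exact hP
  have h2 : volume ((fun s : ℝ => aEps f ε * s) ⁻¹' ((fun s : ℝ => s + aEps f ε) ⁻¹' N)) = 0 := by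
    rw [Real.volume_preimage_mul_left ha.ne', h1, mul_zero]
  refine measure_mono_null ?_ (measure_union_null h1 h2)
  intro s hs
  simp only [mem_ofPred_eq, gEps] at hs
  split_ifs at hs with h
  · right; exact hs
  · left; exact hs

lemma mapL_hasFDerivAt {f : ℝ → ℝ} {ε : ℝ} {z : ℝ × ℝ} (hs : z.1 ≠ 0) {p : ℝ}
    (hp : HasDerivAt (fEps f ε) p (gEps f ε z.1)) :
    HasFDerivAt (mapL f ε)
      ((gEps' f ε z.1 • ContinuousLinearMap.fst ℝ ℝ ℝ).prod
        (fEps f ε (gEps f ε z.1) • ContinuousLinearMap.snd ℝ ℝ ℝ +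
          (z.2 * (p * gEps' f ε z.1)) • ContinuousLinearMap.fst ℝ ℝ ℝ)) z := by
  have hg := gEps_hasDerivAt (f := f) (ε := ε) hs
  have h1 : HasFDerivAt (fun z : ℝ × ℝ => gEps f ε z.1)
      (gEps' f ε z.1 • ContinuousLinearMap.fst ℝ ℝ ℝ) z :=
    hg.comp_hasFDerivAt z hasFDerivAt_fst
  have h2 : HasFDerivAt (fun z : ℝ × ℝ => fEps f ε (gEps f ε z.1))
      ((p * gEps' f ε z.1) • ContinuousLinearMap.fst ℝ ℝ ℝ) z :=
    (hp.comp z.1 hg).comp_hasFDerivAt z hasFDerivAt_fst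
  have h3 := h2.mul (hasFDerivAt_snd (𝕜 := ℝ) (p := z))
  rw [smul_smul] at h3
  exact h1.prodMk h3

lemma det_helper (a b c : ℝ) : LinearMap.det ((((a • ContinuousLinearMap.fst ℝ ℝ ℝ).prod
        (b • ContinuousLinearMap.snd ℝ ℝ ℝ +
          c • ContinuousLinearMap.fst ℝ ℝ ℝ)) : (ℝ × ℝ) →L[ℝ] ℝ × ℝ) : (ℝ × ℝ) →ₗ[ℝ] ℝ × ℝ)
      = a * b := by
  rw [← LinearMap.det_toMatrix (Module.Basis.finTwoProd ℝ), Matrix.det_fin_two]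
  simp [LinearMap.toMatrix_apply]

lemma fEps_mono {f : ℝ → ℝ} (hmono : MonotoneOn f (Set.Ici 0)) (ε : ℝ) :
    MonotoneOn (fEps f ε) (Set.Ici 0) := fun _ hx _ hy h =>
  min_le_min le_rfl (hmono hx hy h)

lemma f_le {f : ℝ → ℝ} (hconc : ConcaveOn ℝ (Set.Ici 0) f) (hf0 : f 0 = 0)
    {d : ℝ} (hd : HasDerivWithinAt f d (Set.Ici 0) 0) {x : ℝ} (hx : 0 < x) : f x ≤ d * x := by
  have h := hconc.slope_le_of_hasDerivWithinAt (x := 0) (y := x) (mem_Ici.2 le_rfl) hx.le hx hd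
  rw [slope_def_field, hf0, sub_zero, sub_zero, div_le_iff₀ hx] at h
  exact h

lemma f_sub_le {f : ℝ → ℝ} (hconc : ConcaveOn ℝ (Set.Ici 0) f) (hf0 : f 0 = 0)
    {d : ℝ} (hd : HasDerivWithinAt f d (Set.Ici 0) 0) {x y : ℝ} (hx : 0 < x) (hxy : x ≤ y) :
    f y - f x ≤ d * (y - x) := by
  rcases hxy.eq_or_lt with rfl | hxy
  · simp
  have h := hconc.slope_anti_adjacent (x := 0) (y := x) (z := y) (mem_Ici.2 le_rfl)
    (hx.trans hxy).le hx hxy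
  have h2 : (f x - f 0) / (x - 0) ≤ d := by
    rw [hf0, sub_zero, sub_zero, div_le_iff₀ hx]; exact f_le hconc hf0 hd hx
  rw [← div_le_iff₀ (by linarith)]
  exact h.trans h2

lemma fEps_lip {f : ℝ → ℝ} (hconc : ConcaveOn ℝ (Set.Ici 0) f)
    (hmono : MonotoneOn f (Set.Ici 0)) (hf0 : f 0 = 0)
    {d : ℝ} (hd : HasDerivWithinAt f d (Set.Ici 0) 0) (ε : ℝ) {x y : ℝ} (hx : 0 < x)
    (hy : 0 < y) : |fEps f ε x - fEps f ε y| ≤ d * |x - y| := by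
  wlog h : x ≤ y generalizing x y
  · rw [abs_sub_comm, abs_sub_comm x]; exact this hy hx (by linarith)
  have h1 := f_sub_le hconc hf0 hd hx h
  have h2 := fEps_mono hmono ε hx.le hy.le h
  have h3 := hmono hx.le hy.le h
  rw [abs_sub_comm, abs_of_nonneg (by linarith), abs_sub_comm, abs_of_nonneg (by linarith)]
  refine le_trans ?_ h1
  unfold fEps
  rcases min_cases ε (f x) with ⟨e, _⟩ | ⟨e, _⟩ <;> rcases min_cases ε (f y) with ⟨e', _⟩ | ⟨e', _⟩
    <;> rw [e, e'] <;> linarith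

lemma fEps_pos {f : ℝ → ℝ} (hconc : ConcaveOn ℝ (Set.Ici 0) f)
    (hmono : MonotoneOn f (Set.Ici 0)) (hf0 : f 0 = 0)
    {ε : ℝ} (hε : 0 < ε) (hεf : ∃ x ∈ Set.Ici (0 : ℝ), ε < f x) {x : ℝ} (hx : 0 < x) :
    0 < fEps f ε x := by
  obtain ⟨X, hX, hfX⟩ := hεf
  refine lt_min hε ?_
  have hX0 : 0 ≤ X := hX
  rcases le_or_gt X x with h | h
  · exact (hε.trans hfX).trans_le (hmono hX hx.le h)
  · have hXp : 0 < X := hx.trans h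
    have hq : x / X ≤ 1 := by rw [div_le_one hXp]; exact h.le
    have := hconc.2 (mem_Ici.2 (le_refl (0 : ℝ))) hX (show 0 ≤ 1 - x / X by linarith)
      (show 0 ≤ x / X by positivity) (by ring)
    simp only [smul_eq_mul, hf0, mul_zero, zero_add] at this
    rw [div_mul_cancel₀ _ hXp.ne'] at this
    refine lt_of_lt_of_le ?_ this
    have : 0 < f X := hε.trans hfX
    positivity

lemma aEps_pos {f : ℝ → ℝ} (hconc : ConcaveOn ℝ (Set.Ici 0) f) (hf0 : f 0 = 0)
    {d : ℝ} (hd : HasDerivWithinAt f d (Set.Ici 0) 0)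
    {ε : ℝ} (hε : 0 < ε) (hεf : ∃ x ∈ Set.Ici (0 : ℝ), ε < f x) : 0 < d ∧ 0 < aEps f ε := by
  obtain ⟨X, hX, hfX⟩ := hεf
  have hXp : 0 < X := by
    rcases (show 0 ≤ X from hX).eq_or_lt with h | h
    · rw [← h, hf0] at hfX; linarith
    · exact h
  have hdp : 0 < d := by
    have := f_le hconc hf0 hd hXp
    by_contra hc
    nlinarith
  refine ⟨hdp, lt_of_lt_of_le (div_pos hε hdp) ?_⟩
  refine le_csInf ⟨X, hXp, hfX.le⟩ ?_
  rintro x ⟨hx, hx'⟩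
  rw [div_le_iff₀ hdp]
  have := f_le hconc hf0 hd hx
  linarith

lemma fEps_le (f : ℝ → ℝ) (ε x : ℝ) : fEps f ε x ≤ ε := min_le_left _ _

lemma mapLinv_mapL {f : ℝ → ℝ} {ε : ℝ} (ha : 0 < aEps f ε)
    (hpos : ∀ x, 0 < x → 0 < fEps f ε x) {z : ℝ × ℝ} (hz : z ∈ domOmega) :
    mapLinv f ε (mapL f ε z) = z := by
  have h1 := hpos _ (gEps_pos ha hz.1)
  simp only [mapLinv, mapL, gInv_gEps ha]
  rw [mul_div_cancel_left₀ _ h1.ne']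

lemma mapL_mapLinv {f : ℝ → ℝ} {ε : ℝ} (ha : 0 < aEps f ε)
    (hpos : ∀ x, 0 < x → 0 < fEps f ε x) {w : ℝ × ℝ} (hw : w ∈ thinOmega f ε) :
    mapL f ε (mapLinv f ε w) = w := by
  have h1 := hpos _ hw.1
  simp only [mapLinv, mapL, gEps_gInv ha]
  rw [mul_div_cancel₀ _ h1.ne']

lemma mapL_mem {f : ℝ → ℝ} {ε : ℝ} (ha : 0 < aEps f ε)
    (hpos : ∀ x, 0 < x → 0 < fEps f ε x) {z : ℝ × ℝ} (hz : z ∈ domOmega) :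
    mapL f ε z ∈ thinOmega f ε := by
  have h0 := gEps_pos ha hz.1
  have h1 := hpos _ h0
  obtain ⟨h2, h3⟩ := hz.2
  refine ⟨h0, mul_pos h1 h2, ?_⟩
  change fEps f ε (gEps f ε z.1) * z.2 < fEps f ε (gEps f ε z.1)
  nlinarith

lemma mapLinv_mem {f : ℝ → ℝ} {ε : ℝ} (ha : 0 < aEps f ε)
    (hpos : ∀ x, 0 < x → 0 < fEps f ε x) {w : ℝ × ℝ} (hw : w ∈ thinOmega f ε) :
    mapLinv f ε w ∈ domOmega := by
  obtain ⟨h0, h1, h2⟩ := hw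
  have h3 := hpos _ h0
  exact ⟨gInv_gt ha h0, div_pos h1 h3, (div_lt_one h3).2 h2⟩

lemma mapL_lip {f : ℝ → ℝ} {ε d : ℝ} (hε : 0 < ε) (ha : 0 < aEps f ε) (hd : 0 < d)
    (hpos : ∀ x, 0 < x → 0 < fEps f ε x)
    (hlip : ∀ x y, 0 < x → 0 < y → |fEps f ε x - fEps f ε y| ≤ d * |x - y|) :
    ∃ Lip : NNReal, LipschitzOnWith Lip (mapL f ε) domOmega := by
  refine lip_helper _ _ (aEps f ε + 1) (d * (aEps f ε + 1)) ε (by positivity) (by positivity)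
    hε.le (fun z _ w _ => gEps_lip ha _ _) ?_
  intro z hz w hw
  have hz0 := gEps_pos ha hz.1
  have hw0 := gEps_pos ha hw.1
  have h1 := hlip _ _ hz0 hw0
  have h2 := gEps_lip ha z.1 w.1
  obtain ⟨t1, t2⟩ := hz.2
  change |fEps f ε (gEps f ε z.1) * z.2 - fEps f ε (gEps f ε w.1) * w.2| ≤ _
  set p := fEps f ε (gEps f ε z.1)
  set q := fEps f ε (gEps f ε w.1)
  have hq0 : 0 < q := hpos _ hw0
  have hq : q ≤ ε := fEps_le _ _ _
  calc |p * z.2 - q * w.2| = |(p - q) * z.2 + q * (z.2 - w.2)| := by ring_nf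
    _ ≤ |p - q| * |z.2| + |q| * |z.2 - w.2| := by
      rw [← abs_mul, ← abs_mul]; exact abs_add_le _ _
    _ ≤ |p - q| * 1 + ε * |z.2 - w.2| := by
      rw [abs_of_pos hq0, abs_of_pos t1]; gcongr
    _ ≤ _ := by
      rw [mul_one, mul_assoc]
      have := h1.trans (mul_le_mul_of_nonneg_left h2 hd.le)
      linarith

lemma fEps_contOn {f : ℝ → ℝ} {ε d : ℝ}  (hd : 0 < d)
    (hlip : ∀ x y, 0 < x → 0 < y → |fEps f ε x - fEps f ε y| ≤ d * |x - y|) :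
    ContinuousOn (fEps f ε) (Ioi 0) :=
  (LipschitzOnWith.of_dist_le_mul (K := ⟨d, hd.le⟩)
    (fun x hx y hy => by rw [Real.dist_eq, Real.dist_eq]; exact hlip x y hx hy)).continuousOn

lemma mapLinv_contOn {f : ℝ → ℝ} {ε d : ℝ} (ha : 0 < aEps f ε) (hd : 0 < d)
    (hpos : ∀ x, 0 < x → 0 < fEps f ε x)
    (hlip : ∀ x y, 0 < x → 0 < y → |fEps f ε x - fEps f ε y| ≤ d * |x - y|) :
    ContinuousOn (mapLinv f ε) (thinOmega f ε) := by
  have h1 : Continuous (gInv (aEps f ε)) :=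
    (LipschitzWith.of_dist_le_mul (K := ⟨(aEps f ε)⁻¹ + 1, by positivity⟩)
    (fun x y => by rw [Real.dist_eq, Real.dist_eq]; exact gInv_lip ha x y)).continuous
  refine ContinuousOn.prodMk (h1.comp continuous_fst).continuousOn ?_
  refine continuous_snd.continuousOn.div ?_ (fun w hw => (hpos _ hw.1).ne')
  exact (fEps_contOn hd hlip).comp continuous_fst.continuousOn (fun w hw => hw.1)

lemma mapLinv_lip {f : ℝ → ℝ} {ε d : ℝ} (ha : 0 < aEps f ε) (hd : 0 < d)
    (hpos : ∀ x, 0 < x → 0 < fEps f ε x)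
    (hlip : ∀ x y, 0 < x → 0 < y → |fEps f ε x - fEps f ε y| ≤ d * |x - y|)
    {K : Set (ℝ × ℝ)} (hK : K ⊆ thinOmega f ε) (hKc : IsCompact K) :
    ∃ Lip : NNReal, LipschitzOnWith Lip (mapLinv f ε) K := by
  have hb : 0 < (aEps f ε)⁻¹ := inv_pos.mpr ha
  obtain ⟨m, hm, hmK⟩ : ∃ m, 0 < m ∧ ∀ z ∈ K, m ≤ fEps f ε z.1 := by
    rcases K.eq_empty_or_nonempty with rfl | hne
    · exact ⟨1, one_pos, by simp⟩
    · obtain ⟨z, hz, hmin⟩ := hKc.exists_isMinOn hne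
        ((fEps_contOn hd hlip).comp continuous_fst.continuousOn (fun w hw => (hK hw).1))
      exact ⟨fEps f ε z.1, hpos _ (hK hz).1, fun w hw => hmin hw⟩
  refine lip_helper _ _ ((aEps f ε)⁻¹ + 1) (1 / m * d) (1 / m) (by positivity) (by positivity)
    (by positivity) (fun z _ w _ => gInv_lip ha _ _) ?_
  intro z hz w hw
  have h1 := hlip _ _ (hK hz).1 (hK hw).1
  have hpz := hmK z hz
  have hpw := hmK w hw
  obtain ⟨-, w1, w2⟩ := hK hw
  change |z.2 / fEps f ε z.1 - w.2 / fEps f ε w.1| ≤ _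
  set p := fEps f ε z.1
  set q := fEps f ε w.1
  have hp0 : 0 < p := hm.trans_le hpz
  have hq0 : 0 < q := hm.trans_le hpw
  calc |z.2 / p - w.2 / q| = |1 / p * (z.2 - w.2) + (1 / p * (w.2 / q)) * (q - p)| := by
        congr 1; field_simp; ring
    _ ≤ |1 / p * (z.2 - w.2)| + |(1 / p * (w.2 / q)) * (q - p)| := abs_add_le _ _
    _ = 1 / p * |z.2 - w.2| + 1 / p * (w.2 / q) * |p - q| := by
      rw [abs_mul, abs_mul, abs_sub_comm q, abs_of_pos (by positivity : 0 < 1 / p),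
        abs_of_pos (by positivity : 0 < 1 / p * (w.2 / q))]
    _ ≤ 1 / m * |z.2 - w.2| + 1 / m * 1 * (d * |z.1 - w.1|) := by
      have : w.2 / q ≤ 1 := (div_le_one hq0).2 w2.le
      gcongr
    _ = _ := by ring

lemma fEps_ae {f : ℝ → ℝ} (hmono : MonotoneOn f (Set.Ici 0)) (ε : ℝ) :
    ∀ᵐ x : ℝ, 0 < x → DifferentiableAt ℝ (fEps f ε) x := by
  have h := ((fEps_mono hmono ε).mono Ioi_subset_Ici_self).ae_differentiableWithinAt_of_mem
  filter_upwards [h] with x hx hx0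
  exact (hx hx0).differentiableAt (Ioi_mem_nhds hx0)

lemma dom_meas : MeasurableSet domOmega := measurableSet_Ioi.prod measurableSet_Ioo

lemma ae_dom {P : ℝ → Prop} (h : ∀ᵐ s : ℝ, -1 < s → P s) :
    ∀ᵐ z ∂(volume.restrict domOmega), P z.1 := by
  rw [ae_restrict_iff' dom_meas]
  have := (Measure.quasiMeasurePreserving_fst (μ := (volume : Measure ℝ))
    (ν := (volume : Measure ℝ))).ae h
  filter_upwards [this] with z hz hz'
  exact hz hz'.1

lemma gEps_continuous {f : ℝ → ℝ} {ε : ℝ} (ha : 0 < aEps f ε) : Continuous (gEps f ε) :=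
  (LipschitzWith.of_dist_le_mul (K := ⟨aEps f ε + 1, by positivity⟩)
    (fun x y => by rw [Real.dist_eq, Real.dist_eq]; exact gEps_lip ha x y)).continuous

lemma ae_good {f : ℝ → ℝ} {ε : ℝ} (hmono : MonotoneOn f (Set.Ici 0)) (ha : 0 < aEps f ε) :
    ∀ᵐ z ∂(volume.restrict domOmega),
      z.1 ≠ 0 ∧ DifferentiableAt ℝ (fEps f ε) (gEps f ε z.1) := by
  refine ae_dom (P := fun s => s ≠ 0 ∧ DifferentiableAt ℝ (fEps f ε) (gEps f ε s)) ?_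
  filter_upwards [ae_comp_gEps ha (fEps_ae hmono ε), Measure.ae_ne volume (0 : ℝ)] with s h1 h2 h3
  exact ⟨h2, h1 (gEps_pos ha h3)⟩

lemma gEps'_pos {f : ℝ → ℝ} {ε : ℝ} (ha : 0 < aEps f ε) (s : ℝ) : 0 < gEps' f ε s := by
  unfold gEps'; split_ifs
  · exact ha
  · exact one_pos

lemma shiftDensity_continuous (x₀ y₀ : ℝ) : Continuous (shiftDensity x₀ y₀) := by
  unfold shiftDensity; fun_prop

lemma main_integral (x₀ y₀ : ℝ) {f : ℝ → ℝ} {ε : ℝ} (hmono : MonotoneOn f (Set.Ici 0))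
    (hε : 0 < ε) (ha : 0 < aEps f ε) (hpos : ∀ x, 0 < x → 0 < fEps f ε x)
    (fε' : ℝ → ℝ)
    (hfε' : ∀ᵐ x ∂(volume.restrict (Set.Ioi (0 : ℝ))), HasDerivAt (fEps f ε) (fε' x) x)
    (u : ℝ × ℝ → ℝ) (hu : ContDiff ℝ 1 u)
    (ψs ψt : ℝ × ℝ → ℝ)
    (hs : ∀ᵐ z ∂(volume.restrict domOmega),
        HasDerivAt (fun s => Real.sqrt ε * u (mapL f ε (s, z.2))) (ψs z) z.1)
    (ht : ∀ᵐ z ∂(volume.restrict domOmega),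
        HasDerivAt (fun t => Real.sqrt ε * u (mapL f ε (z.1, t))) (ψt z) z.2) :
      (∫ z in thinOmega f ε,
          ((fderiv ℝ u z (1, 0)) ^ 2 + (fderiv ℝ u z (0, 1)) ^ 2) ∂(mShift x₀ y₀)) =
        ∫ z in domOmega,
          ((ψs z / gEps' f ε z.1 -
              fε' (gEps f ε z.1) / fEps f ε (gEps f ε z.1) * z.2 * ψt z) ^ 2 +
            (ψt z) ^ 2 / (fEps f ε (gEps f ε z.1)) ^ 2) *
          (shiftDensity x₀ y₀ (mapL f ε z) * gEps' f ε z.1 *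
            fEps f ε (gEps f ε z.1) / ε) := by
  set G : Set (ℝ × ℝ) := domOmega ∩
    (fun z : ℝ × ℝ => z.1) ⁻¹' ({0}ᶜ ∩ gEps f ε ⁻¹' {x | DifferentiableAt ℝ (fEps f ε) x}) with hG
  have hGm : MeasurableSet G :=
    dom_meas.inter (measurable_fst (((measurableSet_singleton 0).compl).inter
      ((gEps_continuous ha).measurable (measurableSet_of_differentiableAt ℝ _))))
  have hGmem : ∀ z, z ∈ G ↔ z ∈ domOmega ∧ z.1 ≠ 0 ∧
      DifferentiableAt ℝ (fEps f ε) (gEps f ε z.1) := fun z => Iff.rfl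
  have hGdom : (G : Set (ℝ × ℝ)) =ᵐ[volume] domOmega := by
    have := ae_good hmono ha
    rw [ae_restrict_iff' dom_meas] at this
    filter_upwards [this] with z hz
    exact propext ⟨fun h => h.1, fun h => ⟨h, hz h⟩⟩
  have hGthin : (mapL f ε '' G : Set (ℝ × ℝ)) =ᵐ[volume] thinOmega f ε := by
    have h1 : ∀ᵐ x : ℝ, x ≠ aEps f ε ∧ (0 < x → DifferentiableAt ℝ (fEps f ε) x) := by
      filter_upwards [fEps_ae hmono ε, Measure.ae_ne volume (aEps f ε)] with x h1 h2
      exact ⟨h2, h1⟩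
    have h2 := (Measure.quasiMeasurePreserving_fst (μ := (volume : Measure ℝ))
      (ν := (volume : Measure ℝ))).ae h1
    filter_upwards [h2] with w hw
    refine propext ⟨?_, fun h => ⟨mapLinv f ε w, ⟨mapLinv_mem ha hpos h, ?_, ?_⟩,
      mapL_mapLinv ha hpos h⟩⟩
    · rintro ⟨z, hz, rfl⟩
      exact mapL_mem ha hpos hz.1
    · intro h0
      have h0' : gInv (aEps f ε) w.1 = 0 := h0
      have := gEps_gInv ha w.1
      rw [h0', gEps, if_neg (lt_irrefl _), zero_add] at this
      exact hw.1 this.symm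
    · change DifferentiableAt ℝ (fEps f ε) (gEps f ε (gInv (aEps f ε) w.1))
      rw [gEps_gInv ha]
      exact hw.2 h.1
  have hinj : InjOn (mapL f ε) G := by
    intro z hz w hw h
    rw [← mapLinv_mapL ha hpos hz.1, h, mapLinv_mapL ha hpos hw.1]
  rw [mShift, setIntegral_withDensity_eq_setIntegral_toReal_smul'
    _ (shiftDensity_continuous x₀ y₀).measurable.ennreal_ofReal
    (Filter.Eventually.of_forall fun _ => ENNReal.ofReal_lt_top),
    ← setIntegral_congr_set hGthin, ← setIntegral_congr_set hGdom,
    integral_image_eq_integral_abs_det_fderiv_smul volume hGm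
      (fun z hz => (mapL_hasFDerivAt hz.2.1 hz.2.2.hasDerivAt).hasFDerivWithinAt) hinj]
  refine setIntegral_congr_ae hGm ?_
  have hfd : ∀ᵐ s : ℝ, 0 < gEps f ε s → HasDerivAt (fEps f ε) (fε' (gEps f ε s)) (gEps f ε s) := by
    rw [ae_restrict_iff' measurableSet_Ioi] at hfε'
    exact ae_comp_gEps ha hfε'
  have hfd2 := (Measure.quasiMeasurePreserving_fst (μ := (volume : Measure ℝ))
      (ν := (volume : Measure ℝ))).ae hfd
  rw [ae_restrict_iff' dom_meas] at hs ht
  filter_upwards [hfd2, hs, ht] with z h1 h2 h3 hz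
  have hgp := gEps_pos ha hz.1.1
  have hφ := hpos _ hgp
  have hg' := gEps'_pos ha z.1
  replace h1 := h1 hgp
  replace h2 := h2 hz.1
  replace h3 := h3 hz.1
  have hL := mapL_hasFDerivAt hz.2.1 h1
  have hU := (hu.differentiable one_ne_zero (mapL f ε z)).hasFDerivAt
  have hUL := hU.comp z hL
  have hlin : ∀ p q : ℝ, fderiv ℝ u (mapL f ε z) (p, q) =
      p * fderiv ℝ u (mapL f ε z) (1, 0) + q * fderiv ℝ u (mapL f ε z) (0, 1) := by
    intro p q
    have : ((p, q) : ℝ × ℝ) = p • (1, 0) + q • (0, 1) := by simp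
    rw [this, map_add, map_smul, map_smul, smul_eq_mul, smul_eq_mul]
  have k2 : HasDerivAt (fun s => Real.sqrt ε * u (mapL f ε (s, z.2))) _ z.1 :=
    (HasFDerivAt.comp_hasDerivAt_of_eq z.1 (f := fun s => (s, z.2)) hUL
      ((hasDerivAt_id z.1).prodMk (hasDerivAt_const z.1 z.2)) rfl).const_mul (Real.sqrt ε)
  have k3 : HasDerivAt (fun t => Real.sqrt ε * u (mapL f ε (z.1, t))) _ z.2 :=
    (HasFDerivAt.comp_hasDerivAt_of_eq z.2 (f := fun t => (z.1, t)) hUL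
      ((hasDerivAt_const z.2 z.1).prodMk (hasDerivAt_id z.2)) rfl).const_mul (Real.sqrt ε)
  have e2 := h2.unique k2
  have e3 := h3.unique k3
  simp only [ContinuousLinearMap.comp_apply, ContinuousLinearMap.prod_apply,
    ContinuousLinearMap.add_apply, ContinuousLinearMap.smul_apply, ContinuousLinearMap.coe_fst',
    ContinuousLinearMap.coe_snd', smul_eq_mul, mul_one, mul_zero, zero_add, add_zero] at e2 e3
  rw [hlin] at e2 e3
  have hdet := det_helper (gEps' f ε z.1) (fEps f ε (gEps f ε z.1))
    (z.2 * (deriv (fEps f ε) (gEps f ε z.1) * gEps' f ε z.1))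
  rw [ContinuousLinearMap.det, hdet, e2, e3, abs_of_pos (mul_pos hg' hφ),
    ENNReal.toReal_ofReal (show 0 ≤ shiftDensity x₀ y₀ (mapL f ε z) from (Real.exp_pos _).le)]
  set A := fderiv ℝ u (mapL f ε z) (1, 0)
  set B := fderiv ℝ u (mapL f ε z) (0, 1)
  set S := shiftDensity x₀ y₀ (mapL f ε z)
  set φ := fEps f ε (gEps f ε z.1)
  set g' := gEps' f ε z.1
  set p := fε' (gEps f ε z.1)
  simp only [smul_eq_mul]
  have hsq : Real.sqrt ε ^ 2 = ε := Real.sq_sqrt hε.le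
  have x1 : √ε * (g' * A + z.2 * (p * g') * B) / g' - p / φ * z.2 * (√ε * (0 * A + φ * B))
      = √ε * A := by field_simp; ring
  have x2 : (√ε * (0 * A + φ * B)) ^ 2 / φ ^ 2 = ε * B ^ 2 := by
    rw [mul_pow, hsq]; field_simp; ring
  rw [x1, x2, mul_pow, hsq]
  field_simp

/-- The map `ℒ_ε` is a homeomorphism of `Ω = (-1,∞)×(0,1)` onto `Ω_ε`, Lipschitz on
compact subsets together with its inverse, with Jacobian `j_ε(s,t) = g_ε'(s) f_ε(g_ε(s))`,
and for every compactly supported `C¹` function `u`, with `ψ = √ε · (u ∘ ℒ_ε)`, the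
change-of-variables identity for the weighted Dirichlet integral holds. -/
theorem mapL_change_of_variables (x₀ y₀ : ℝ) (f : ℝ → ℝ)
    (hconc : ConcaveOn ℝ (Set.Ici 0) f)
    (hmono : MonotoneOn f (Set.Ici 0))
    (hcont : ContinuousOn f (Set.Ici 0))
    (hnonneg : ∀ x ∈ Set.Ici (0 : ℝ), 0 ≤ f x)
    (hf0 : f 0 = 0)
    (hnontriv : ∃ x ∈ Set.Ici (0 : ℝ), f x ≠ 0)
    (d : ℝ) (hd : HasDerivWithinAt f d (Set.Ici 0) 0)
    (ε : ℝ) (hε : 0 < ε) (hεf : ∃ x ∈ Set.Ici (0 : ℝ), ε < f x) :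
    (∃ h : ↥domOmega ≃ₜ ↥(thinOmega f ε),
        ∀ z : ↥domOmega, (h z : ℝ × ℝ) = mapL f ε (z : ℝ × ℝ)) ∧
    (∀ K ⊆ domOmega, IsCompact K → ∃ Lip : NNReal, LipschitzOnWith Lip (mapL f ε) K) ∧
    (∃ Linv : ℝ × ℝ → ℝ × ℝ,
        (∀ z ∈ domOmega, Linv (mapL f ε z) = z) ∧
        (∀ w ∈ thinOmega f ε, mapL f ε (Linv w) = w) ∧
        (∀ K ⊆ thinOmega f ε, IsCompact K → ∃ Lip : NNReal, LipschitzOnWith Lip Linv K)) ∧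
    (∀ᵐ z ∂(volume.restrict domOmega), ∃ D : ℝ × ℝ →L[ℝ] ℝ × ℝ,
        HasFDerivAt (mapL f ε) D z ∧
        LinearMap.det (D : (ℝ × ℝ) →ₗ[ℝ] ℝ × ℝ) = jacEps f ε z) ∧
    (∀ fε' : ℝ → ℝ,
      (∀ᵐ x ∂(volume.restrict (Set.Ioi (0 : ℝ))), HasDerivAt (fEps f ε) (fε' x) x) →
      ∀ u : ℝ × ℝ → ℝ, ContDiff ℝ 1 u → HasCompactSupport u →
      ∀ ψs ψt : ℝ × ℝ → ℝ,
      (∀ᵐ z ∂(volume.restrict domOmega),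
        HasDerivAt (fun s => Real.sqrt ε * u (mapL f ε (s, z.2))) (ψs z) z.1) →
      (∀ᵐ z ∂(volume.restrict domOmega),
        HasDerivAt (fun t => Real.sqrt ε * u (mapL f ε (z.1, t))) (ψt z) z.2) →
      (∫ z in thinOmega f ε,
          ((fderiv ℝ u z (1, 0)) ^ 2 + (fderiv ℝ u z (0, 1)) ^ 2) ∂(mShift x₀ y₀)) =
        ∫ z in domOmega,
          ((ψs z / gEps' f ε z.1 -
              fε' (gEps f ε z.1) / fEps f ε (gEps f ε z.1) * z.2 * ψt z) ^ 2 +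
            (ψt z) ^ 2 / (fEps f ε (gEps f ε z.1)) ^ 2) *
          (shiftDensity x₀ y₀ (mapL f ε z) * gEps' f ε z.1 *
            fEps f ε (gEps f ε z.1) / ε)) := by
  obtain ⟨hdp, ha⟩ := aEps_pos hconc hf0 hd hε hεf
  have hpos : ∀ x, 0 < x → 0 < fEps f ε x := fun x hx => fEps_pos hconc hmono hf0 hε hεf hx
  have hlip : ∀ x y, 0 < x → 0 < y → |fEps f ε x - fEps f ε y| ≤ d * |x - y| :=
    fun x y hx hy => fEps_lip hconc hmono hf0 hd ε hx hy
  obtain ⟨C, hC⟩ := mapL_lip hε ha hdp hpos hlip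
  refine ⟨⟨⟨⟨fun z => ⟨mapL f ε z, mapL_mem ha hpos z.2⟩,
      fun w => ⟨mapLinv f ε w, mapLinv_mem ha hpos w.2⟩,
      fun z => Subtype.ext (mapLinv_mapL ha hpos z.2),
      fun w => Subtype.ext (mapL_mapLinv ha hpos w.2)⟩, ?_, ?_⟩, fun z => rfl⟩,
    fun K hK _ => ⟨C, hC.mono hK⟩,
    ⟨mapLinv f ε, fun z hz => mapLinv_mapL ha hpos hz, fun w hw => mapL_mapLinv ha hpos hw,
      fun K hK hKc => mapLinv_lip ha hdp hpos hlip hK hKc⟩, ?_, ?_⟩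
  · exact (continuousOn_iff_continuous_domRestrict.1 hC.continuousOn).subtype_mk _
  · exact (continuousOn_iff_continuous_domRestrict.1
      (mapLinv_contOn ha hdp hpos hlip)).subtype_mk _
  · filter_upwards [ae_good hmono ha] with z hz
    exact ⟨_, mapL_hasFDerivAt hz.1 hz.2.hasDerivAt, by rw [det_helper, jacEps]⟩
  · intro fε' hfε' u hu _ ψs ψt hs ht
    exact main_integral x₀ y₀ hmono hε ha hpos fε' hfε' u hu ψs ψt hs ht
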